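/- Let I ⊆ M_n be a decreasing set of monomials. The code C(I)^⊥ = C(M_n \ Ī) is triply-even if and only if (M_n \ Ī)·(M_n \ Ī) ⊆ I, where Ī = {ᾱ : α ∈ I} and the product of two sets of monomials is the set of pairwise products. -/

import Mathlib

/-- The evaluation vector of the monomial with support `S ⊆ {0,…,n−1}`. -/
def ev {n : ℕ} (S : Finset (Fin n)) : (Fin n → ZMod 2) → ZMod 2 :=
  fun u => ∏ i ∈ S, u i

/-- Same-degree comparison of monomials via their sorted supports. -/
def sameDegLE {n : ℕ} (S T : Finset (Fin n)) : Prop :=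
  List.Forall₂ (· ≤ ·) (S.sort (· ≤ ·)) (T.sort (· ≤ ·))

/-- The strong order on monomials (identified with their supports). -/
def strongLE {n : ℕ} (S T : Finset (Fin n)) : Prop :=
  (S.card = T.card ∧ sameDegLE S T) ∨
  (S.card < T.card ∧ ∃ T' : Finset (Fin n), T'.card = S.card ∧ sameDegLE S T' ∧ T' ⊆ T)

/-- A set of monomials `I` is decreasing iff `g ∈ I` and `f ≼ g` imply `f ∈ I`. -/
def Decreasing {n : ℕ} (I : Set (Finset (Fin n))) : Prop :=
  ∀ ⦃f g : Finset (Fin n)⦄, g ∈ I → strongLE f g → f ∈ I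

/-- The monomial code `C(I)`: the `F_2`-span of the evaluation vectors of `I`. -/
def monomialCode {n : ℕ} (I : Set (Finset (Fin n))) :
    Submodule (ZMod 2) ((Fin n → ZMod 2) → ZMod 2) :=
  Submodule.span (ZMod 2) (ev '' I)

/-- A subspace `V ⊆ F_2^N` (coordinates indexed by a finite type `ι`) is
triply-even iff for all `u, v, w ∈ V` the number of coordinates where `u`, `v`,
`w` are all `1` is even. -/
def TriplyEven {ι : Type*} [Fintype ι] [DecidableEq ι]
    (V : Submodule (ZMod 2) (ι → ZMod 2)) : Prop :=
  ∀ u ∈ V, ∀ v ∈ V, ∀ w ∈ V,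
    Even (Finset.univ.filter (fun i : ι => u i = 1 ∧ v i = 1 ∧ w i = 1)).card

lemma strongLE_of_subset {n : ℕ} {S T : Finset (Fin n)} (h : S ⊆ T) : strongLE S T := by
  have hrefl : sameDegLE S S := List.forall₂_same.2 fun _ _ => le_rfl
  rcases (Finset.card_le_card h).eq_or_lt with hc | hc
  · obtain rfl := Finset.eq_of_subset_of_card_le h hc.ge
    exact Or.inl ⟨rfl, hrefl⟩
  · exact Or.inr ⟨hc, S, rfl, hrefl, h⟩

lemma Decreasing.mem_of_subset {n : ℕ} {I : Set (Finset (Fin n))} (hI : Decreasing I)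
    {S T : Finset (Fin n)} (hT : T ∈ I) (h : S ⊆ T) : S ∈ I :=
  hI hT (strongLE_of_subset h)

lemma ev_eq_prod_univ {n : ℕ} (S : Finset (Fin n)) (u : Fin n → ZMod 2) :
    ev S u = ∏ i, if i ∈ S then u i else 1 := by
  simp [ev]

lemma ev_mul_ev {n : ℕ} (S T : Finset (Fin n)) : ev S * ev T = ev (S ∪ T) := by
  have idem : ∀ a : ZMod 2, a * a = a := by decide
  funext u
  rw [Pi.mul_apply, ev_eq_prod_univ, ev_eq_prod_univ, ev_eq_prod_univ, ← Finset.prod_mul_distrib]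
  refine Finset.prod_congr rfl fun i _ => ?_
  by_cases hS : i ∈ S <;> by_cases hT : i ∈ T <;> simp [hS, hT, idem]

/-- Summing a monomial over the whole cube detects whether it has full support. -/
lemma sum_ev_eq_zero_iff {n : ℕ} (S : Finset (Fin n)) : ∑ u, ev S u = 0 ↔ S ≠ Finset.univ := by
  have hsum : ∑ u, ev S u = ∏ i, ∑ a : ZMod 2, if i ∈ S then a else 1 := by
    rw [Finset.prod_univ_sum, Fintype.piFinset_univ]
    exact Finset.sum_congr rfl fun u _ => ev_eq_prod_univ S u
  have hid : ∑ a : ZMod 2, a = 1 := by decide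
  have hone : ∑ _a : ZMod 2, (1 : ZMod 2) = 0 := by decide
  rw [hsum, Finset.prod_eq_zero_iff, Ne, Finset.eq_univ_iff_forall, not_forall]
  refine ⟨fun ⟨i, _, hi⟩ => ⟨i, fun hS => ?_⟩, fun ⟨i, hi⟩ => ⟨i, Finset.mem_univ i, ?_⟩⟩
  · simp only [if_pos hS, hid] at hi
    exact one_ne_zero hi
  · simp only [if_neg hi, hone]

lemma even_card_filter_iff_sum_eq_zero {ι : Type*} [Fintype ι] (u v w : ι → ZMod 2) :
    Even (Finset.univ.filter (fun i : ι => u i = 1 ∧ v i = 1 ∧ w i = 1)).card ↔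
      ∑ i, u i * v i * w i = 0 := by
  have key : ∀ a b c : ZMod 2, a * b * c = if a = 1 ∧ b = 1 ∧ c = 1 then 1 else 0 := by decide
  simp only [key, Finset.sum_boole, ZMod.natCast_eq_zero_iff_even]

/-- Triple evenness of a span may be checked on generators. -/
lemma triplyEven_span_iff {ι : Type*} [Fintype ι] [DecidableEq ι] (s : Set (ι → ZMod 2)) :
    TriplyEven (Submodule.span (ZMod 2) s) ↔
      ∀ u ∈ s, ∀ v ∈ s, ∀ w ∈ s, ∑ i, u i * v i * w i = 0 := by
  simp only [TriplyEven, even_card_filter_iff_sum_eq_zero]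
  refine ⟨fun h u hu v hv w hw => h u (Submodule.subset_span hu) v (Submodule.subset_span hv) w
    (Submodule.subset_span hw), fun h u hu v hv w hw => ?_⟩
  induction hu using Submodule.span_induction with
  | zero => simp
  | add x y _ _ hx hy => simp only [Pi.add_apply, add_mul, Finset.sum_add_distrib, hx, hy, add_zero]
  | smul a x _ hx =>
    simp only [Pi.smul_apply, smul_eq_mul, mul_assoc, ← Finset.mul_sum] at hx ⊢
    rw [hx, mul_zero]
  | mem u hu =>
    induction hv using Submodule.span_induction with
    | zero => simp
    | add x y _ _ hx hy =>
      simp only [Pi.add_apply, mul_add, add_mul, Finset.sum_add_distrib, hx, hy, add_zero]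
    | smul a x _ hx =>
      simp only [Pi.smul_apply, smul_eq_mul, mul_left_comm _ a, mul_assoc, ← Finset.mul_sum]
        at hx ⊢
      rw [hx, mul_zero]
    | mem v hv =>
      induction hw using Submodule.span_induction with
      | zero => simp
      | add x y _ _ hx hy =>
        simp only [Pi.add_apply, mul_add, Finset.sum_add_distrib, hx, hy, add_zero]
      | smul a x _ hx =>
        simp only [Pi.smul_apply, smul_eq_mul, mul_left_comm _ a, ← Finset.mul_sum]
        rw [hx, mul_zero]
      | mem w hw => exact h u hu v hv w hw

lemma triplyEven_monomialCode_iff {n : ℕ} (J : Set (Finset (Fin n))) :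
    TriplyEven (monomialCode J) ↔
      ∀ S ∈ J, ∀ T ∈ J, ∀ U ∈ J, S ∪ T ∪ U ≠ Finset.univ := by
  have hprod (S T U : Finset (Fin n)) (x : Fin n → ZMod 2) :
      ev S x * ev T x * ev U x = ev (S ∪ T ∪ U) x := by
    rw [← ev_mul_ev, ← ev_mul_ev, Pi.mul_apply, Pi.mul_apply]
  simp only [monomialCode, triplyEven_span_iff, Set.forall_mem_image, hprod, sum_ev_eq_zero_iff]

/-- for a decreasing set `I ⊆ M_n`, the dual code
`C(I)^⊥ = C(M_n \ Ī)` is triply-even iff `(M_n \ Ī)·(M_n \ Ī) ⊆ I`,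
where `Ī = {ᾱ : α ∈ I}` and the product of sets is the set of pairwise products. -/
theorem triplyEven_dual_iff_subset (n : ℕ) (I : Set (Finset (Fin n)))
    (hI : Decreasing I) :
    TriplyEven (monomialCode (((fun S : Finset (Fin n) => Sᶜ) '' I)ᶜ)) ↔
      Set.image2 (· ∪ ·) (((fun S : Finset (Fin n) => Sᶜ) '' I)ᶜ)
        (((fun S : Finset (Fin n) => Sᶜ) '' I)ᶜ) ⊆ I := by
  have hmem (S : Finset (Fin n)) : S ∈ ((fun S : Finset (Fin n) => Sᶜ) '' I)ᶜ ↔ Sᶜ ∉ I := by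
    rw [Set.mem_compl_iff, Set.image_eq_preimage_of_inverse compl_compl compl_compl,
      Set.mem_preimage]
  simp only [triplyEven_monomialCode_iff, Set.image2_subset_iff, hmem]
  refine ⟨fun h S hS T hT => ?_, fun h S hS T hT U hU huniv => ?_⟩
  · by_contra hST
    exact h S hS T hT (S ∪ T)ᶜ (by rwa [compl_compl]) (Finset.union_compl _)
  · refine hU (hI.mem_of_subset (h S hS T hT) fun i hi => ?_)
    have hi' := huniv ▸ Finset.mem_univ i
    exact (Finset.mem_union.1 hi').resolve_right (Finset.mem_compl.1 hi)
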